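/- Let A be a local algebra with maximal ideal I_A and residue homomorphism 0_A : A → ℝ, let m ≥ 1, and fix x₀ ∈ ℝ^m. For i = 1, …, m let xⁱ : ℝ^m → ℝ denote the smooth coordinate function xⁱ(x) = x_i − (x₀)_i. Then the map u ↦ (u(x¹), …, u(x^m)) is a bijection from the set A_{x₀}ℝ^m = { u : C^∞(ℝ^m) → A identity-preserving ℝ-algebra homomorphism : 0_A ∘ u = ev_{x₀} } onto (I_A)^m; in particular, every identity-preserving ℝ-algebra homomorphism u : C^∞(ℝ^m) → A with 0_A ∘ u = ev_{x₀} is uniquely determined by its values on the coordinate functions x¹, …, x^m, and every m-tuple of elements of I_A arises from such a homomorphism. -/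

import Mathlib

open scoped Manifold

/-- The `i`-th Cartesian coordinate function `xⁱ(x) = xᵢ − (x₀)ᵢ` at `x₀ ∈ ℝ^m`, as a smooth
map `ℝ^m → ℝ`. -/
def coordFn (m : ℕ) (x₀ : Fin m → ℝ) (i : Fin m) :
    ContMDiffMap 𝓘(ℝ, Fin m → ℝ) 𝓘(ℝ, ℝ) (Fin m → ℝ) ℝ (⊤ : ℕ∞) :=
  ⟨fun x => x i - x₀ i,
    (((ContinuousLinearMap.proj i : (Fin m → ℝ) →L[ℝ] ℝ).contDiff).sub
      contDiff_const).contMDiff⟩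

section ParametricIntegral

variable {E F : Type} [NormedAddCommGroup E] [NormedSpace ℝ E] [ProperSpace E]
  [NormedAddCommGroup F] [NormedSpace ℝ F]

/-- Differentiation under the integral sign for a `C¹` integrand on a compact interval. -/
theorem ContDiff.hasFDerivAt_intervalIntegral {h : E × ℝ → F} (hh : ContDiff ℝ 1 h)
    (a b : ℝ) (x : E) :
    HasFDerivAt (fun x => ∫ t in a..b, h (x, t))
      (∫ t in a..b, (fderiv ℝ h (x, t)).comp (ContinuousLinearMap.inl ℝ E ℝ)) x := by
  have hc : Continuous fun p : E × ℝ =>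
      (fderiv ℝ h p).comp (ContinuousLinearMap.inl ℝ E ℝ) :=
    (hh.continuous_fderiv one_ne_zero).clm_comp continuous_const
  obtain ⟨C, hC⟩ := ((isCompact_closedBall x 1).prod
    (isCompact_uIcc (a := a) (b := b))).exists_bound_of_continuousOn hc.continuousOn
  refine intervalIntegral.hasFDerivAt_integral_of_dominated_of_fderiv_le (bound := fun _ => C)
    (F := fun x t => h (x, t))
    (F' := fun x t => (fderiv ℝ h (x, t)).comp (ContinuousLinearMap.inl ℝ E ℝ))
    (Metric.closedBall_mem_nhds x one_pos) ?_ ?_ ?_ ?_ intervalIntegrable_const ?_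
  · exact .of_forall fun y =>
      (hh.continuous.comp (Continuous.prodMk_right y)).aestronglyMeasurable
  · exact (hh.continuous.comp (Continuous.prodMk_right x)).intervalIntegrable _ _
  · exact (hc.comp (Continuous.prodMk_right x)).aestronglyMeasurable
  · exact .of_forall fun t ht y hy => hC (y, t) ⟨hy, Set.uIoc_subset_uIcc ht⟩
  · refine .of_forall fun t _ y _ => ?_
    exact ((hh.differentiable one_ne_zero) (y, t)).hasFDerivAt.comp y
      (hasFDerivAt_prodMk_left y t)

/-- The integral over a compact interval of a smooth function is smooth in the parameter. -/
theorem ContDiff.parametric_intervalIntegral {h : E × ℝ → F} (hh : ContDiff ℝ (⊤ : ℕ∞) h)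
    (a b : ℝ) : ContDiff ℝ (⊤ : ℕ∞) fun x => ∫ t in a..b, h (x, t) := by
  refine contDiff_infty.2 fun n => ?_
  induction n generalizing F with
  | zero =>
    exact contDiff_zero.2 (intervalIntegral.continuous_parametric_intervalIntegral_of_continuous'
      (f := fun x t => h (x, t)) hh.continuous a b)
  | succ n ih =>
    refine contDiff_succ_iff_hasFDerivAt.2 ⟨_, ?_, fun x =>
      (hh.of_le (by exact_mod_cast le_top)).hasFDerivAt_intervalIntegral a b x⟩
    exact ih (h := fun p => (fderiv ℝ h p).comp (ContinuousLinearMap.inl ℝ E ℝ))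
      ((contDiff_infty_iff_fderiv.1 hh).2.clm_comp contDiff_const)

end ParametricIntegral

theorem MvPolynomial.IsHomogeneous.aeval_mem_pow {σ R A : Type*} [CommSemiring R] [CommSemiring A]
    [Algebra R A] {p : MvPolynomial σ R} {n : ℕ} (hp : p.IsHomogeneous n) {I : Ideal A}
    {v : σ → A} (hv : ∀ i, v i ∈ I) : MvPolynomial.aeval v p ∈ I ^ n := by
  rw [MvPolynomial.aeval_def, MvPolynomial.eval₂_eq]
  refine Ideal.sum_mem _ fun d hd => Ideal.mul_mem_left _ _ ?_
  rw [hp.degree_eq_sum_deg_support hd, ← Finset.prod_pow_eq_pow_sum]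
  exact Ideal.prod_mem_prod fun i _ => Ideal.pow_mem_pow (hv i) _

theorem MvPolynomial.IsHomogeneous.eval_smul {σ R : Type*} [CommSemiring R]
    {p : MvPolynomial σ R} {n : ℕ} (hp : p.IsHomogeneous n) (t : R) (y : σ → R) :
    MvPolynomial.eval (t • y) p = t ^ n * MvPolynomial.eval y p := by
  rw [MvPolynomial.eval_eq, MvPolynomial.eval_eq, Finset.mul_sum]
  refine Finset.sum_congr rfl fun d hd => ?_
  simp only [Pi.smul_apply, smul_eq_mul, mul_pow, Finset.prod_mul_distrib,
    Finset.prod_pow_eq_pow_sum, ← hp.degree_eq_sum_deg_support hd]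
  ring

/-- A real polynomial vanishing to order `k` at `0` has no coefficients of degree less than `k`. -/
theorem Polynomial.coeff_eq_zero_of_eval_eq_pow_mul {k : ℕ} {q : Polynomial ℝ} {g : ℝ → ℝ}
    (hg : Continuous g) (h : ∀ t, q.eval t = t ^ k * g t) {j : ℕ} (hj : j < k) :
    q.coeff j = 0 := by
  induction k generalizing q j with
  | zero => omega
  | succ k ih =>
    have h0 : q.coeff 0 = 0 := by
      rw [Polynomial.coeff_zero_eq_eval_zero, h]
      simp
    have hq : q = Polynomial.X * q.divX := by
      conv_lhs => rw [← Polynomial.X_mul_divX_add q, h0]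
      simp
    cases j with
    | zero => exact h0
    | succ j =>
      rw [← Polynomial.coeff_divX]
      refine ih (fun t => ?_) (by omega)
      have hEq : Set.EqOn (fun t => q.divX.eval t) (fun t => t ^ k * g t) {0}ᶜ := by
        intro t ht
        have := h t
        rw [hq] at this
        rw [Polynomial.eval_mul, Polynomial.eval_X, pow_succ', mul_assoc] at this
        exact mul_left_cancel₀ ht this
      exact congrFun (Continuous.ext_on (dense_compl_singleton 0) (by fun_prop) (by fun_prop) hEq) t

/-- The ring of smooth real functions on `ℝ^m`. -/
local notation "SmoothFn" m =>
  ContMDiffMap 𝓘(ℝ, Fin m → ℝ) 𝓘(ℝ, ℝ) (Fin m → ℝ) ℝ (⊤ : ℕ∞)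

section SmoothFunctions

variable {m : ℕ}

/-- **Hadamard's lemma**. -/
theorem exists_eq_algebraMap_add_sum_coordFn_mul (x₀ : Fin m → ℝ) (f : SmoothFn m) :
    ∃ g : Fin m → SmoothFn m,
      f = algebraMap ℝ (SmoothFn m) (f x₀) + ∑ i, coordFn m x₀ i * g i := by
  have hf : ContDiff ℝ (⊤ : ℕ∞) f := f.contMDiff.contDiff
  have hf' : ContDiff ℝ (⊤ : ℕ∞) (fderiv ℝ f) := (contDiff_infty_iff_fderiv.1 hf).2
  let h (i : Fin m) (p : (Fin m → ℝ) × ℝ) : ℝ :=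
    fderiv ℝ f (x₀ + p.2 • (p.1 - x₀)) (Pi.single i 1)
  have hh (i) : ContDiff ℝ (⊤ : ℕ∞) (h i) := by
    refine (hf'.comp ?_).clm_apply contDiff_const
    fun_prop
  let g (i : Fin m) : SmoothFn m := ⟨fun x => ∫ t in (0 : ℝ)..1, h i (x, t),
    ((hh i).parametric_intervalIntegral 0 1).contMDiff⟩
  refine ⟨g, ?_⟩
  ext x
  have hsum (y : Fin m → ℝ) :
      fderiv ℝ f y (x - x₀) = ∑ i, (x i - x₀ i) * fderiv ℝ f y (Pi.single i 1) := by
    have hx : x - x₀ = ∑ i, (x i - x₀ i) • Pi.single i (1 : ℝ) := by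
      ext j
      simp [Pi.single_apply]
    conv_lhs => rw [hx]
    simp only [map_sum, map_smul, smul_eq_mul]
  have hint : ∫ t in (0 : ℝ)..1, fderiv ℝ f (x₀ + t • (x - x₀)) (x - x₀) = f x - f x₀ := by
    have hd (t : ℝ) : HasDerivAt (fun t : ℝ => f (x₀ + t • (x - x₀)))
        (fderiv ℝ f (x₀ + t • (x - x₀)) (x - x₀)) t := by
      refine ((hf.differentiable (by simp)) _).hasFDerivAt.comp_hasDerivAt t ?_
      simpa using ((hasDerivAt_id t).smul_const (x - x₀)).const_add x₀
    rw [intervalIntegral.integral_eq_sub_of_hasDerivAt (fun t _ => hd t)]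
    · simp
    · refine Continuous.intervalIntegrable ?_ _ _
      exact (hf'.continuous.comp (by fun_prop)).clm_apply continuous_const
  have hcont (i) : Continuous fun t : ℝ => h i (x, t) :=
    (hh i).continuous.comp (Continuous.prodMk_right x)
  simp_rw [hsum] at hint
  rw [intervalIntegral.integral_finsetSum
    fun i _ => ((hcont i).const_mul _).intervalIntegrable _ _] at hint
  simp_rw [intervalIntegral.integral_const_mul] at hint
  have hco : (∑ i, coordFn m x₀ i * g i) x =
      ∑ i, (x i - x₀ i) * ∫ t in (0 : ℝ)..1, h i (x, t) := by
    rw [← ContMDiffMap.coeFnAlgHom_apply, map_sum, Finset.sum_apply]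
    rfl
  rw [ContMDiffMap.coe_add, Pi.add_apply, hco, hint]
  change f x = f x₀ + _
  ring

/-- The ideal of smooth functions generated by the coordinate functions at `x₀`. -/
noncomputable def coordIdeal (x₀ : Fin m → ℝ) : Ideal (SmoothFn m) :=
  Ideal.span (Set.range (coordFn m x₀))

theorem coordFn_mem_coordIdeal (x₀ : Fin m → ℝ) (i : Fin m) : coordFn m x₀ i ∈ coordIdeal x₀ :=
  Ideal.subset_span ⟨i, rfl⟩

/-- Taylor expansion: modulo any power of the ideal of the point `x₀`, every smooth function is a
polynomial in the coordinate functions. -/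
theorem exists_sub_aeval_coordFn_mem_pow (x₀ : Fin m → ℝ) (k : ℕ) (f : SmoothFn m) :
    ∃ p : MvPolynomial (Fin m) ℝ,
      f - MvPolynomial.aeval (coordFn m x₀) p ∈ coordIdeal x₀ ^ k := by
  induction k generalizing f with
  | zero => exact ⟨0, by simp⟩
  | succ k ih =>
    obtain ⟨g, hg⟩ := exists_eq_algebraMap_add_sum_coordFn_mul x₀ f
    choose p hp using fun i => ih (g i)
    refine ⟨MvPolynomial.C (f x₀) + ∑ i, MvPolynomial.X i * p i, ?_⟩
    have : f - MvPolynomial.aeval (coordFn m x₀)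
        (MvPolynomial.C (f x₀) + ∑ i, MvPolynomial.X i * p i) =
        ∑ i, coordFn m x₀ i * (g i - MvPolynomial.aeval (coordFn m x₀) (p i)) := by
      simp only [map_add, map_sum, map_mul, MvPolynomial.aeval_X, MvPolynomial.aeval_C, mul_sub,
        Finset.sum_sub_distrib]
      linear_combination hg
    rw [this, pow_succ']
    exact Ideal.sum_mem _ fun i _ => Ideal.mul_mem_mul (coordFn_mem_coordIdeal x₀ i) (hp i)

/-- Restriction of smooth functions to the line through `x₀` with direction `y`. -/
noncomputable def restrictLine (x₀ y : Fin m → ℝ) : (SmoothFn m) →ₐ[ℝ] C(ℝ, ℝ) where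
  toFun f := ⟨fun t => f (x₀ + t • y), f.contMDiff.continuous.comp (by fun_prop)⟩
  map_one' := rfl
  map_mul' _ _ := rfl
  map_zero' := rfl
  map_add' _ _ := rfl
  commutes' _ := rfl

theorem restrictLine_coordFn (x₀ y : Fin m → ℝ) (i : Fin m) :
    restrictLine x₀ y (coordFn m x₀ i) = y i • ContinuousMap.id ℝ := by
  ext t
  change (x₀ + t • y) i - x₀ i = y i * t
  simp [mul_comm]

theorem exists_restrictLine_eq_pow_mul {x₀ : Fin m → ℝ} {k : ℕ} {f : SmoothFn m}
    (hf : f ∈ coordIdeal x₀ ^ k) (y : Fin m → ℝ) :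
    ∃ g : C(ℝ, ℝ), restrictLine x₀ y f = ContinuousMap.id ℝ ^ k * g := by
  have h : coordIdeal x₀ ≤ (Ideal.span {ContinuousMap.id ℝ}).comap (restrictLine x₀ y) := by
    refine Ideal.span_le.2 ?_
    rintro _ ⟨i, rfl⟩
    change restrictLine x₀ y _ ∈ Ideal.span {ContinuousMap.id ℝ}
    rw [restrictLine_coordFn]
    exact Submodule.smul_of_tower_mem _ _ (Ideal.mem_span_singleton_self _)
  have h2 := (Ideal.pow_right_mono h k).trans (Ideal.le_comap_pow _ k) hf
  rw [Ideal.mem_comap, Ideal.span_singleton_pow, Ideal.mem_span_singleton] at h2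
  exact h2

/-- The homogeneous components of degree less than `k` vanish for a polynomial in the coordinate
functions that lies in the `k`-th power of the ideal of the point. -/
theorem homogeneousComponent_eq_zero_of_aeval_coordFn_mem_pow {x₀ : Fin m → ℝ} {k : ℕ}
    {p : MvPolynomial (Fin m) ℝ}
    (hp : MvPolynomial.aeval (coordFn m x₀) p ∈ coordIdeal x₀ ^ k) {j : ℕ} (hj : j < k) :
    MvPolynomial.homogeneousComponent j p = 0 := by
  refine MvPolynomial.funext fun y => ?_
  rw [map_zero]
  obtain ⟨g, hg⟩ := exists_restrictLine_eq_pow_mul hp y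
  let q : Polynomial ℝ := ∑ i ∈ Finset.range (p.totalDegree + 1),
    Polynomial.C (MvPolynomial.eval y (MvPolynomial.homogeneousComponent i p)) * Polynomial.X ^ i
  have hq (t : ℝ) : q.eval t = t ^ k * g t := by
    have h1 : restrictLine x₀ y (MvPolynomial.aeval (coordFn m x₀) p) t =
        MvPolynomial.eval (t • y) p := by
      have : ((ContinuousMap.evalAlgHom ℝ ℝ t).comp (restrictLine x₀ y)).comp
          (MvPolynomial.aeval (coordFn m x₀)) = MvPolynomial.aeval (t • y) := by
        ext i
        simp [restrictLine_coordFn, mul_comm]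
      exact DFunLike.congr_fun this p
    rw [hg] at h1
    change t ^ k * g t = _ at h1
    rw [h1]
    conv_rhs => rw [← MvPolynomial.sum_homogeneousComponent p]
    rw [map_sum, Polynomial.eval_finsetSum]
    refine Finset.sum_congr rfl fun i _ => ?_
    rw [(MvPolynomial.homogeneousComponent_isHomogeneous i p).eval_smul, Polynomial.eval_mul,
      Polynomial.eval_C, Polynomial.eval_pow, Polynomial.eval_X, mul_comm]
  have := Polynomial.coeff_eq_zero_of_eval_eq_pow_mul g.continuous hq hj
  rw [Polynomial.finsetSum_coeff] at this
  simp only [Polynomial.coeff_C_mul_X_pow, Finset.sum_ite_eq, Finset.mem_range] at this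
  split_ifs at this with hlt
  · exact this
  · rw [MvPolynomial.homogeneousComponent_eq_zero _ _ (by omega), map_zero]

end SmoothFunctions

section LiftAlgHom

variable {m : ℕ} {A : Type*} [CommRing A] [Algebra ℝ A] {I : Ideal A}

theorem aeval_eq_zero_of_aeval_coordFn_mem_pow {x₀ : Fin m → ℝ} {k : ℕ} (hI : I ^ k = ⊥)
    {v : Fin m → A} (hv : ∀ i, v i ∈ I) {p : MvPolynomial (Fin m) ℝ}
    (hp : MvPolynomial.aeval (coordFn m x₀) p ∈ coordIdeal x₀ ^ k) :
    MvPolynomial.aeval v p = 0 := by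
  rw [← MvPolynomial.sum_homogeneousComponent p, map_sum]
  refine Finset.sum_eq_zero fun j _ => ?_
  rcases lt_or_ge j k with hj | hj
  · rw [homogeneousComponent_eq_zero_of_aeval_coordFn_mem_pow hp hj, map_zero]
  · have := Ideal.pow_le_pow_right hj
      ((MvPolynomial.homogeneousComponent_isHomogeneous j p).aeval_mem_pow hv)
    rwa [hI, Ideal.mem_bot] at this

/-- Every tuple of elements of a nilpotent ideal is the tuple of values of an algebra homomorphism
on the coordinate functions. -/
theorem exists_algHom_coordFn_eq (x₀ : Fin m → ℝ) (hI : IsNilpotent I) {v : Fin m → A}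
    (hv : ∀ i, v i ∈ I) :
    ∃ u : (SmoothFn m) →ₐ[ℝ] A, ∀ i, u (coordFn m x₀ i) = v i := by
  obtain ⟨k, hk⟩ := hI
  let π := (Ideal.Quotient.mkₐ ℝ (coordIdeal x₀ ^ k)).comp (MvPolynomial.aeval (coordFn m x₀))
  have hπ : Function.Surjective π := by
    intro b
    obtain ⟨f, rfl⟩ := Ideal.Quotient.mk_surjective b
    obtain ⟨p, hp⟩ := exists_sub_aeval_coordFn_mem_pow x₀ k f
    exact ⟨p, (Ideal.Quotient.eq.2 hp).symm⟩
  have hker : RingHom.ker π.toRingHom ≤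
      RingHom.ker (MvPolynomial.aeval (R := ℝ) v).toRingHom := fun p hp =>
    aeval_eq_zero_of_aeval_coordFn_mem_pow hk hv (Ideal.Quotient.eq_zero_iff_mem.1 hp)
  refine ⟨(AlgHom.liftOfSurjective π hπ _ hker).comp (Ideal.Quotient.mkₐ ℝ _), fun i => ?_⟩
  have := AlgHom.liftOfSurjective_apply π hπ _ hker (MvPolynomial.X i)
  simpa [π] using this

/-- Two algebra homomorphisms that agree on the coordinate functions, with values there in a
nilpotent ideal, are equal. -/
theorem algHom_eq_of_coordFn_eq {x₀ : Fin m → ℝ} (hI : IsNilpotent I)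
    {u w : (SmoothFn m) →ₐ[ℝ] A} (hu : ∀ i, u (coordFn m x₀ i) ∈ I)
    (h : ∀ i, u (coordFn m x₀ i) = w (coordFn m x₀ i)) : u = w := by
  obtain ⟨k, hk⟩ := hI
  have key (n : ℕ) (f : SmoothFn m) : u f - w f ∈ I ^ n := by
    induction n generalizing f with
    | zero => simp
    | succ n ih =>
      obtain ⟨g, hg⟩ := exists_eq_algebraMap_add_sum_coordFn_mul x₀ f
      have : u f - w f = ∑ i, u (coordFn m x₀ i) * (u (g i) - w (g i)) := by
        rw [hg]
        simp only [map_add, map_sum, map_mul, AlgHom.commutes, mul_sub, Finset.sum_sub_distrib, h]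
        ring
      rw [this, pow_succ']
      exact Ideal.sum_mem _ fun i _ => Ideal.mul_mem_mul (hu i) (ih (g i))
  ext f
  have := key k f
  rw [hk] at this
  exact sub_eq_zero.1 this

end LiftAlgHom

/-- Let `A` be a local algebra with maximal ideal `I_A` and residue
homomorphism `0_A : A → ℝ`, let `m ≥ 1`, and fix `x₀ ∈ ℝ^m`.  Then the map
`u ↦ (u(x¹), …, u(x^m))` is a bijection from the set
`A_{x₀}ℝ^m = {u : C^∞(ℝ^m) → A | 0_A ∘ u = ev_{x₀}}` of identity-preserving `ℝ`-algebra
homomorphisms onto `(I_A)^m`: every such homomorphism is uniquely determined by its values on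
the coordinate functions `x¹, …, x^m`, and every `m`-tuple of elements of `I_A` arises from
such a homomorphism. -/
theorem pointsProches_affine_space_bijection
    (A : Type) [CommRing A] [Algebra ℝ A] [FiniteDimensional ℝ A] [IsLocalRing A]
    (hres : Nonempty (IsLocalRing.ResidueField A ≃ₐ[ℝ] ℝ))
    (ρ : A →ₐ[ℝ] ℝ)
    (m : ℕ) (hm : 1 ≤ m) (x₀ : Fin m → ℝ) :
    Set.BijOn
      (fun u : (ContMDiffMap 𝓘(ℝ, Fin m → ℝ) 𝓘(ℝ, ℝ) (Fin m → ℝ) ℝ (⊤ : ℕ∞)) →ₐ[ℝ] A =>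
        fun i : Fin m => u (coordFn m x₀ i))
      {u : (ContMDiffMap 𝓘(ℝ, Fin m → ℝ) 𝓘(ℝ, ℝ) (Fin m → ℝ) ℝ (⊤ : ℕ∞)) →ₐ[ℝ] A |
        ∀ f : ContMDiffMap 𝓘(ℝ, Fin m → ℝ) 𝓘(ℝ, ℝ) (Fin m → ℝ) ℝ (⊤ : ℕ∞), ρ (u f) = f x₀}
      {v : Fin m → A | ∀ i : Fin m, v i ∈ IsLocalRing.maximalIdeal A} := by
  have hker : RingHom.ker ρ = IsLocalRing.maximalIdeal A :=
    IsLocalRing.eq_maximalIdeal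
      (RingHom.ker_isMaximal_of_surjective ρ fun r => ⟨algebraMap ℝ A r, by simp⟩)
  have : IsArtinianRing A := IsArtinianRing.of_finite ℝ A
  have hnil : IsNilpotent (IsLocalRing.maximalIdeal A) :=
    (isArtinianRing_iff_isNilpotent_maximalIdeal A).1 this
  have hmem {u : (SmoothFn m) →ₐ[ℝ] A} (hu : ∀ f : SmoothFn m, ρ (u f) = f x₀) (i : Fin m) :
      u (coordFn m x₀ i) ∈ IsLocalRing.maximalIdeal A := by
    rw [← hker, RingHom.mem_ker, hu]
    exact sub_self (x₀ i)
  refine ⟨fun u hu => hmem hu, fun u hu w _ h =>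
    algHom_eq_of_coordFn_eq hnil (hmem hu) (congrFun h), fun v hv => ?_⟩
  obtain ⟨u, hu⟩ := exists_algHom_coordFn_eq x₀ hnil hv
  refine ⟨u, fun f => ?_, funext hu⟩
  obtain ⟨g, hg⟩ := exists_eq_algebraMap_add_sum_coordFn_mul x₀ f
  have hv0 (i) : ρ (v i) = 0 := by
    rw [← RingHom.mem_ker, hker]
    exact hv i
  conv_lhs => rw [hg]
  simp [hu, hv0]
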